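/- Let D be a Hausdorff topological space carrying an observation W-atlas with W compact. Let ∼ be the equivalence relation on D given by x ∼ y :⇔ y ∈ F_x (membership in the same fiber). Then the quotient space D/∼, equipped with the quotient topology, is Hausdorff. -/

import Mathlib

/-- An observation `W`-atlas on `D` (Definition 4/5 of the paper): a family of triples
`(V i, φ i, Θ i)` where the `V i` are open sets covering `D`, the `Θ i ⊆ ℝ^p` are open,
each `φ i : V i ≃ₜ Θ i × W` is a homeomorphism (subspace topology on `V i`), and on chart
overlaps the fiber `φ_i⁻¹({φ_i¹ x} × W)` through a point does not depend on the chart. -/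
structure ObservationWAtlas (D : Type*) [TopologicalSpace D] (W : Type*) [TopologicalSpace W]
    (p : ℕ) (I : Type*) where
  V : I → Set D
  Θ : I → Set (Fin p → ℝ)
  isOpen_V : ∀ i, IsOpen (V i)
  isOpen_Θ : ∀ i, IsOpen (Θ i)
  covers : ∀ x : D, ∃ i, x ∈ V i
  φ : ∀ i, (V i) ≃ₜ (Θ i) × W
  compat : ∀ i j (x : D) (hxi : x ∈ V i) (hxj : x ∈ V j),
    {y : D | ∃ hy : y ∈ V i, ((φ i) ⟨y, hy⟩).1 = ((φ i) ⟨x, hxi⟩).1} =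
    {y : D | ∃ hy : y ∈ V j, ((φ j) ⟨y, hy⟩).1 = ((φ j) ⟨x, hxj⟩).1}

/-- The fiber `F_x = φ_i⁻¹({φ_i¹ x} × W)` through `x ∈ V i`, viewed as a subset of `D`. -/
def ObservationWAtlas.fiber {D : Type*} [TopologicalSpace D] {W : Type*} [TopologicalSpace W]
    {p : ℕ} {I : Type*} (A : ObservationWAtlas D W p I) (i : I) (x : D) (hx : x ∈ A.V i) :
    Set D :=
  {y : D | ∃ hy : y ∈ A.V i, ((A.φ i) ⟨y, hy⟩).1 = ((A.φ i) ⟨x, hx⟩).1}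

namespace ObservationWAtlas

variable {D : Type*} [TopologicalSpace D] {W : Type*} [TopologicalSpace W] {p : ℕ} {I : Type*}
  (A : ObservationWAtlas D W p I)

theorem exists_mem_fiber_iff {i : I} {x y : D} (hx : x ∈ A.V i) :
    (∃ j, ∃ hxj : x ∈ A.V j, y ∈ A.fiber j x hxj) ↔ y ∈ A.fiber i x hx := by
  refine ⟨fun ⟨j, hxj, hy⟩ => ?_, fun hy => ⟨i, hx, hy⟩⟩
  have h : A.fiber j x hxj = A.fiber i x hx := A.compat j i x hxj hx
  exact h ▸ hy

/-- The equivalence relation whose classes are the fibers. -/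
def fiberSetoid : Setoid D where
  r x y := ∃ i, ∃ hx : x ∈ A.V i, y ∈ A.fiber i x hx
  iseqv :=
    { refl := fun x => by
        obtain ⟨i, hx⟩ := A.covers x
        exact ⟨i, hx, hx, rfl⟩
      symm := fun ⟨i, hx, hy, h⟩ => ⟨i, hy, hx, h.symm⟩
      trans := by
        rintro x y z ⟨i, hx, hy, h⟩ hyz
        obtain ⟨hz, h'⟩ := (A.exists_mem_fiber_iff hy).1 hyz
        exact ⟨i, hx, hz, h'.trans h⟩ }

theorem fiber_eq_range {i : I} {x : D} (hx : x ∈ A.V i) :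
    A.fiber i x hx = Set.range fun w : W => ((A.φ i).symm ((A.φ i ⟨x, hx⟩).1, w) : D) := by
  ext y
  constructor
  · rintro ⟨hy, h⟩
    exact ⟨(A.φ i ⟨y, hy⟩).2, by simp [← h]⟩
  · rintro ⟨w, rfl⟩
    exact ⟨Subtype.coe_prop _, by simp⟩

theorem isCompact_fiber [CompactSpace W] {i : I} {x : D} (hx : x ∈ A.V i) :
    IsCompact (A.fiber i x hx) := by
  rw [A.fiber_eq_range hx]
  exact isCompact_range (by fun_prop)

theorem isCompact_setOf_fiberSetoid [CompactSpace W] (x : D) :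
    IsCompact {y | A.fiberSetoid x y} := by
  obtain ⟨i, hx⟩ := A.covers x
  have h : {y | A.fiberSetoid x y} = A.fiber i x hx :=
    Set.ext fun y => A.exists_mem_fiber_iff hx
  exact h ▸ A.isCompact_fiber hx

/-- The union of the fibers contained in an open set is open. -/
theorem isOpen_setOf_fiber_subset [CompactSpace W] {U : Set D} (hU : IsOpen U) :
    IsOpen {x | ∀ y, A.fiberSetoid x y → y ∈ U} := by
  refine isOpen_iff_mem_nhds.2 fun x hx => ?_
  obtain ⟨i, hxi⟩ := A.covers x
  let S : Set (A.Θ i × W) := {q | ((A.φ i).symm q : D) ∈ U}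
  have hS : IsOpen S := hU.preimage (by fun_prop)
  have hT : IsOpen (Prod.fst '' Sᶜ)ᶜ :=
    (isClosedMap_fst_of_compactSpace _ hS.isClosed_compl).isOpen_compl
  have hO : IsOpen {v : A.V i | (A.φ i v).1 ∈ (Prod.fst '' Sᶜ)ᶜ} := hT.preimage (by fun_prop)
  have key : ∀ v : A.V i, (A.φ i v).1 ∈ (Prod.fst '' Sᶜ)ᶜ ↔
      ∀ y, A.fiberSetoid v y → y ∈ U := by
    intro v
    have hv : ∀ y, A.fiberSetoid v y ↔ y ∈ A.fiber i v v.2 :=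
      fun y => A.exists_mem_fiber_iff v.2
    simp only [hv, A.fiber_eq_range, Set.forall_mem_range]
    simp [S]
  simp only [key] at hO
  refine Filter.mem_of_superset
    (((A.isOpen_V i).isOpenMap_subtype_val _ hO).mem_nhds ⟨⟨x, hxi⟩, hx, rfl⟩) ?_
  rintro _ ⟨v, hv, rfl⟩
  exact hv

theorem t2Space_quotient_fiberSetoid [T2Space D] [CompactSpace W] :
    T2Space (Quotient A.fiberSetoid) := by
  refine ⟨fun a b => Quotient.inductionOn₂ a b fun x y hxy => ?_⟩
  have hdisj : Disjoint {z | A.fiberSetoid x z} {z | A.fiberSetoid y z} :=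
    Set.disjoint_left.2 fun z hx hy =>
      hxy (Quotient.sound (A.fiberSetoid.trans hx (A.fiberSetoid.symm hy)))
  obtain ⟨U, V, hU, hV, hxU, hyV, hUV⟩ :=
    SeparatedNhds.of_isCompact_isCompact (A.isCompact_setOf_fiberSetoid x)
      (A.isCompact_setOf_fiberSetoid y) hdisj
  let sat (O : Set D) : Set (Quotient A.fiberSetoid) :=
    {q | ∀ z, Quotient.mk _ z = q → z ∈ O}
  have mem_sat (O : Set D) (z : D) :
      Quotient.mk A.fiberSetoid z ∈ sat O ↔ ∀ w, A.fiberSetoid z w → w ∈ O :=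
    forall_congr' fun w => imp_congr_left
      (Quotient.eq.trans ⟨A.fiberSetoid.symm, A.fiberSetoid.symm⟩)
  have isOpen_sat {O : Set D} (hO : IsOpen O) : IsOpen (sat O) := by
    refine isQuotientMap_quotient_mk'.isOpen_preimage.1 ?_
    convert A.isOpen_setOf_fiber_subset hO using 1
    exact Set.ext (mem_sat O)
  refine ⟨sat U, sat V, isOpen_sat hU, isOpen_sat hV, (mem_sat U x).2 hxU, (mem_sat V y).2 hyV,
    Set.disjoint_left.2 fun q => Quotient.inductionOn q fun z hzU hzV => ?_⟩
  exact Set.disjoint_left.1 hUV (hzU z rfl) (hzV z rfl)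

end ObservationWAtlas

/-- Let `D` be a Hausdorff space carrying an observation `W`-atlas
with `W` compact, and let `r` be the relation "being in the same fiber",
`x ∼ y :⇔ y ∈ F_x`. Then the quotient space `D/∼`, with the quotient topology,
is Hausdorff. -/
theorem observationWAtlas_quotient_t2
    {D : Type*} [TopologicalSpace D] [T2Space D]
    {W : Type*} [TopologicalSpace W] [CompactSpace W]
    {p : ℕ} {I : Type*} (A : ObservationWAtlas D W p I)
    (r : D → D → Prop)
    (hr : ∀ x y : D, r x y ↔ ∃ i, ∃ hx : x ∈ A.V i, y ∈ A.fiber i x hx) :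
    T2Space (Quot r) := by
  obtain rfl : r = A.fiberSetoid.r := funext₂ fun x y => propext (hr x y)
  exact A.t2Space_quotient_fiberSetoid
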